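/- Let G be a connected weighted partial 2-tree that is not outerplanar, let {u,v} be a vertex separator of G such that G − {u,v} has at least three components, let H be a component of G − {u,v} with V(lsp(u,v)) ∩ V(H) = ∅ and E(lsp(u,v)) ∩ E(H) = ∅, and let G₁, G₂ be obtained by decomp(G,u,v). Then for each i ∈ {1,2}, every lex short cycle of G_i (with inherited weights and induced vertex order) is a lex short cycle of G. -/

import Mathlib

/-!
Common definitions for formalizing "Minimum Cycle Basis in Weighted Partial 2-trees".
-/

namespace LexMCB

open SimpleGraph

variable {V : Type*}

/-- The weight of a walk: the sum of the weights of its edges. -/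
def walkWeight {G : SimpleGraph V} (w : Sym2 V → ℕ) {a b : V} (p : G.Walk a b) : ℕ :=
  (p.edges.map w).sum

/-- A walk is contained in the subgraph described by vertex set `V₁` and edge set `E₁`. -/
def WalkIn {G : SimpleGraph V} (V₁ : Set V) (E₁ : Set (Sym2 V)) {a b : V}
    (p : G.Walk a b) : Prop :=
  (∀ t ∈ p.support, t ∈ V₁) ∧ ∀ e ∈ p.edges, e ∈ E₁

/-- `p` is lexicographically better than `q`: either it has smaller weight, or equal weight
and fewer edges, or equal weight and equally many edges and
`min (V(q) \ V(p)) > min (V(p) \ V(q))`. -/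
def LexBetter [LinearOrder V] {G : SimpleGraph V} (w : Sym2 V → ℕ) {a b : V}
    (p q : G.Walk a b) : Prop :=
  walkWeight w p < walkWeight w q ∨
    (walkWeight w q = walkWeight w p ∧ p.length < q.length) ∨
    (walkWeight w q = walkWeight w p ∧ q.length = p.length ∧
      (p.support.toFinset \ q.support.toFinset).min <
        (q.support.toFinset \ p.support.toFinset).min)

/-- `p` is the lex shortest path between its endpoints among the paths lying in the
subgraph described by vertex set `V₁` and edge set `E₁`. -/
def IsLexShortestPathIn [LinearOrder V] {G : SimpleGraph V} (w : Sym2 V → ℕ)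
    (V₁ : Set V) (E₁ : Set (Sym2 V)) {a b : V} (p : G.Walk a b) : Prop :=
  p.IsPath ∧ WalkIn V₁ E₁ p ∧
    ∀ q : G.Walk a b, q.IsPath → WalkIn V₁ E₁ q → q ≠ p → LexBetter w p q

/-- `p` is the lex shortest path of `G` between its endpoints. -/
def IsLexShortestPath [LinearOrder V] {G : SimpleGraph V} (w : Sym2 V → ℕ)
    {a b : V} (p : G.Walk a b) : Prop :=
  IsLexShortestPathIn w Set.univ G.edgeSet p

/-- A (sub)graph is a cycle: it is connected and every vertex has degree two. -/
def IsCycleSubgraph {G : SimpleGraph V} (C : G.Subgraph) : Prop :=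
  C.Connected ∧ ∀ t ∈ C.verts, (C.neighborSet t).ncard = 2

/-- `C` is a lex short cycle of the subgraph of `G` described by vertex set `V₁` and
edge set `E₁`: it is a cycle lying there, and for any two distinct vertices `x,y` of `C`
the lex shortest `x`-`y` path of that subgraph is contained in `C`. -/
def IsLexShortCycleIn [LinearOrder V] {G : SimpleGraph V} (w : Sym2 V → ℕ)
    (V₁ : Set V) (E₁ : Set (Sym2 V)) (C : G.Subgraph) : Prop :=
  C.verts ⊆ V₁ ∧ C.edgeSet ⊆ E₁ ∧ IsCycleSubgraph C ∧
    ∀ x ∈ C.verts, ∀ y ∈ C.verts, x ≠ y →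
      ∀ p : G.Walk x y, IsLexShortestPathIn w V₁ E₁ p → ∀ e ∈ p.edges, e ∈ C.edgeSet

/-- The set of lex short cycles of the subgraph of `G` described by `V₁`, `E₁`. -/
def LSCIn [LinearOrder V] (G : SimpleGraph V) (w : Sym2 V → ℕ)
    (V₁ : Set V) (E₁ : Set (Sym2 V)) : Set G.Subgraph :=
  {C | IsLexShortCycleIn w V₁ E₁ C}

/-- The set of lex short cycles of `G`. -/
def LSC [LinearOrder V] (G : SimpleGraph V) (w : Sym2 V → ℕ) : Set G.Subgraph :=
  LSCIn G w Set.univ G.edgeSet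

/-! ### Components and separators -/

/-- The edges of `G` lying within the vertex set `H`. -/
def edgesWithin (G : SimpleGraph V) (H : Set V) : Set (Sym2 V) :=
  {e | e ∈ G.edgeSet ∧ ∀ t ∈ e, t ∈ H}

/-- `H` is (the vertex set of) a connected component of the induced subgraph `G[A]`:
it is a maximal subset of `A` inducing a connected subgraph. -/
def IsComponentOf (G : SimpleGraph V) (A : Set V) (H : Set V) : Prop :=
  H.Nonempty ∧ H ⊆ A ∧ (G.induce H).Connected ∧
    ∀ K : Set V, H ⊆ K → K ⊆ A → (G.induce K).Connected → K = H

/-- `{u, v}` is a vertex separator of `G` : deleting `u` and `v` disconnects `G`. -/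
def IsSeparatorPair (G : SimpleGraph V) (u v : V) : Prop :=
  ¬ (G.induce {t | t ≠ u ∧ t ≠ v}).Connected

/-- The number of connected components of `G - {u, v}`. -/
noncomputable def numComponentsDel (G : SimpleGraph V) (u v : V) : ℕ :=
  Nat.card ((G.induce {t | t ≠ u ∧ t ≠ v}).ConnectedComponent)

/-! ### Subdivisions of `K₄` and `K_{2,3}`, outerplanarity -/

/-- The interior (internal vertices) of a walk. -/
def walkInterior {G : SimpleGraph V} {a b : V} (p : G.Walk a b) : Set V :=
  {t | t ∈ p.support} \ {a, b}

/-- A `K_{2,3}`-subdivision in `G` with branch vertices `u, v` (the side of size two)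
and `x, y, z` (the side of size three): six internally disjoint paths joining each of
`u, v` to each of `x, y, z`, whose interiors avoid the branch vertices. -/
structure K23Subdiv (G : SimpleGraph V) (u v x y z : V) where
  pux : G.Walk u x
  puy : G.Walk u y
  puz : G.Walk u z
  pvx : G.Walk v x
  pvy : G.Walk v y
  pvz : G.Walk v z
  branch_nodup : List.Pairwise (· ≠ ·) [u, v, x, y, z]
  isPath_pux : pux.IsPath
  isPath_puy : puy.IsPath
  isPath_puz : puz.IsPath
  isPath_pvx : pvx.IsPath
  isPath_pvy : pvy.IsPath
  isPath_pvz : pvz.IsPath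
  interiors_disjoint : List.Pairwise Disjoint
    [walkInterior pux, walkInterior puy, walkInterior puz,
     walkInterior pvx, walkInterior pvy, walkInterior pvz]
  interiors_avoid_branch : ∀ s ∈ [walkInterior pux, walkInterior puy, walkInterior puz,
      walkInterior pvx, walkInterior pvy, walkInterior pvz],
    ∀ t ∈ s, t ∉ ({u, v, x, y, z} : Set V)

/-- The vertex set of a `K_{2,3}`-subdivision. -/
def K23Subdiv.vertSet {G : SimpleGraph V} {u v x y z : V} (K : K23Subdiv G u v x y z) :
    Set V :=
  {t | t ∈ K.pux.support ∨ t ∈ K.puy.support ∨ t ∈ K.puz.support ∨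
       t ∈ K.pvx.support ∨ t ∈ K.pvy.support ∨ t ∈ K.pvz.support}

/-- The edge set of a `K_{2,3}`-subdivision. -/
def K23Subdiv.edges {G : SimpleGraph V} {u v x y z : V} (K : K23Subdiv G u v x y z) :
    Set (Sym2 V) :=
  {e | e ∈ K.pux.edges ∨ e ∈ K.puy.edges ∨ e ∈ K.puz.edges ∨
       e ∈ K.pvx.edges ∨ e ∈ K.pvy.edges ∨ e ∈ K.pvz.edges}

/-- `G` contains a subdivision of `K_{2,3}`. -/
def HasK23Subdivision (G : SimpleGraph V) : Prop :=
  ∃ u v x y z : V, Nonempty (K23Subdiv G u v x y z)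

/-- The subgraph `S` of `G` is (exactly) a `K_{2,3}`-subdivision. -/
def IsK23SubdivisionSubgraph {G : SimpleGraph V} (S : G.Subgraph) : Prop :=
  ∃ (u v x y z : V) (K : K23Subdiv G u v x y z),
    K.vertSet = S.verts ∧ K.edges = S.edgeSet

/-- A `K₄`-subdivision in `G` with branch vertices `a, b, c, d`. -/
structure K4Subdiv (G : SimpleGraph V) (a b c d : V) where
  pab : G.Walk a b
  pac : G.Walk a c
  pad : G.Walk a d
  pbc : G.Walk b c
  pbd : G.Walk b d
  pcd : G.Walk c d
  branch_nodup : List.Pairwise (· ≠ ·) [a, b, c, d]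
  isPath_pab : pab.IsPath
  isPath_pac : pac.IsPath
  isPath_pad : pad.IsPath
  isPath_pbc : pbc.IsPath
  isPath_pbd : pbd.IsPath
  isPath_pcd : pcd.IsPath
  interiors_disjoint : List.Pairwise Disjoint
    [walkInterior pab, walkInterior pac, walkInterior pad,
     walkInterior pbc, walkInterior pbd, walkInterior pcd]
  interiors_avoid_branch : ∀ s ∈ [walkInterior pab, walkInterior pac, walkInterior pad,
      walkInterior pbc, walkInterior pbd, walkInterior pcd],
    ∀ t ∈ s, t ∉ ({a, b, c, d} : Set V)

/-- `G` contains a subdivision of `K₄`. -/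
def HasK4Subdivision (G : SimpleGraph V) : Prop :=
  ∃ a b c d : V, Nonempty (K4Subdiv G a b c d)

/-- `G` is outerplanar.  (We use the classical combinatorial characterization:
a graph is outerplanar iff it has no subgraph that is a subdivision of `K₄` or of
`K_{2,3}`.) -/
def IsOuterplanar (G : SimpleGraph V) : Prop :=
  ¬ HasK4Subdivision G ∧ ¬ HasK23Subdivision G

/-! ### 2-trees and partial 2-trees -/

/-- Add to `G` a new vertex adjacent to (exactly) `a` and `b`. -/
def addVertexOnEdge {n : ℕ} (G : SimpleGraph (Fin n)) (a b : Fin n) :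
    SimpleGraph (Fin (n + 1)) :=
  SimpleGraph.fromRel fun i j =>
    (∃ i' j' : Fin n, i = Fin.castSucc i' ∧ j = Fin.castSucc j' ∧ G.Adj i' j') ∨
    (i = Fin.last n ∧ (j = Fin.castSucc a ∨ j = Fin.castSucc b))

/-- 2-trees, defined inductively: `K₃` is a 2-tree, and adding a new vertex whose
neighbourhood is an edge of a 2-tree again gives a 2-tree. -/
inductive IsTwoTree : ∀ {n : ℕ}, SimpleGraph (Fin n) → Prop
  | base : IsTwoTree (⊤ : SimpleGraph (Fin 3))
  | extend {n : ℕ} (G : SimpleGraph (Fin n)) (a b : Fin n) :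
      IsTwoTree G → G.Adj a b → IsTwoTree (addVertexOnEdge G a b)

/-- A partial 2-tree: a subgraph of a 2-tree. -/
def IsPartialTwoTree {W : Type*} (G : SimpleGraph W) : Prop :=
  ∃ (n : ℕ) (T : SimpleGraph (Fin n)) (f : W ↪ Fin n),
    IsTwoTree T ∧ ∀ x y : W, G.Adj x y → T.Adj (f x) (f y)

/-! ### The cycle space over `𝔽₂`, cycle bases and minimum cycle bases -/

/-- The incidence vector (over `𝔽₂`) of a subgraph, indexed by `Sym2 V`. -/
noncomputable def cycleIncVec {G : SimpleGraph V} (C : G.Subgraph) : Sym2 V → ZMod 2 :=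
  C.edgeSet.indicator fun _ => 1

/-- The cycle space of `G`: the span over `𝔽₂` of the incidence vectors of cycles. -/
def cycleSpace (G : SimpleGraph V) : Submodule (ZMod 2) (Sym2 V → ZMod 2) :=
  Submodule.span (ZMod 2) (cycleIncVec '' {C : G.Subgraph | IsCycleSubgraph C})

/-- `B` is a cycle basis of `G`: a minimum-cardinality set of cycles whose incidence
vectors span the cycle space of `G`. -/
def IsCycleBasis (G : SimpleGraph V) (B : Set G.Subgraph) : Prop :=
  (∀ C ∈ B, IsCycleSubgraph C) ∧
    Submodule.span (ZMod 2) (cycleIncVec '' B) = cycleSpace G ∧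
    ∀ B' : Set G.Subgraph, (∀ C ∈ B', IsCycleSubgraph C) →
      Submodule.span (ZMod 2) (cycleIncVec '' B') = cycleSpace G → B.ncard ≤ B'.ncard

/-- The weight of a cycle: the sum of the weights of its edges. -/
noncomputable def cycleWeight {G : SimpleGraph V} (w : Sym2 V → ℕ) (C : G.Subgraph) : ℕ :=
  ∑ᶠ e ∈ C.edgeSet, w e

/-- The total weight of a set of cycles. -/
noncomputable def basisWeight {G : SimpleGraph V} (w : Sym2 V → ℕ)
    (B : Set G.Subgraph) : ℕ :=
  ∑ᶠ C ∈ B, cycleWeight w C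

/-- `B` is a minimum cycle basis of `G`: a cycle basis of minimum total weight. -/
def IsMinimumCycleBasis (G : SimpleGraph V) (w : Sym2 V → ℕ) (B : Set G.Subgraph) : Prop :=
  IsCycleBasis G B ∧ ∀ B' : Set G.Subgraph, IsCycleBasis G B' →
    basisWeight w B ≤ basisWeight w B'

/-! ### The `decomp` operation -/

/-- The vertex set of the first part `G₁` of `decomp(G,u,v)`. -/
def decompVerts1 {G : SimpleGraph V} {u v : V} (P : G.Walk u v) (H : Set V) : Set V :=
  H ∪ {t | t ∈ P.support}

/-- The edge set of the first part `G₁` of `decomp(G,u,v)`: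
`E(H) ∪ E(lsp(u,v)) ∪ {(x,y) : x ∈ V(H), y ∈ {u,v}, (x,y) ∈ E(G)}`. -/
def decompEdges1 {G : SimpleGraph V} {u v : V} (P : G.Walk u v) (H : Set V) :
    Set (Sym2 V) :=
  edgesWithin G H ∪ {e | e ∈ P.edges} ∪
    {e | ∃ a ∈ H, ∃ c ∈ ({u, v} : Set V), G.Adj a c ∧ e = s(a, c)}


theorem walkWeight_append {G : SimpleGraph V} (w : Sym2 V → ℕ) {a b c : V}
    (p : G.Walk a b) (q : G.Walk b c) :
    walkWeight w (p.append q) = walkWeight w p + walkWeight w q := by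
  simp [walkWeight]

theorem walkWeight_reverse {G : SimpleGraph V} (w : Sym2 V → ℕ) {a b : V}
    (p : G.Walk a b) : walkWeight w p.reverse = walkWeight w p := by
  simp [walkWeight, List.sum_reverse]

theorem walkWeight_bypass_le [DecidableEq V] {G : SimpleGraph V} (w : Sym2 V → ℕ) {a b : V}
    (p : G.Walk a b) : walkWeight w p.bypass ≤ walkWeight w p :=
  (p.edges_bypass_sublist_edges.map w).sum_le_sum (by simp)

theorem walkIn_univ_edgeSet {G : SimpleGraph V} {a b : V} (p : G.Walk a b) :
    WalkIn Set.univ G.edgeSet p :=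
  ⟨fun _ _ => Set.mem_univ _, fun _ he => p.edges_subset_edgeSet he⟩

theorem exists_eq_append_cons_of_mem_edges {G : SimpleGraph V} {a b : V} (p : G.Walk a b)
    {e : Sym2 V} (he : e ∈ p.edges) :
    ∃ (c d : V) (h : G.Adj c d) (p₁ : G.Walk a c) (p₂ : G.Walk d b),
      e = s(c, d) ∧ p = p₁.append (.cons h p₂) := by
  induction p with
  | nil => simp at he
  | cons h p ih =>
    rw [Walk.edges_cons, List.mem_cons] at he
    rcases he with rfl | he
    · exact ⟨_, _, h, .nil, p, rfl, rfl⟩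
    · obtain ⟨c, d, h', p₁, p₂, rfl, rfl⟩ := ih he
      exact ⟨c, d, h', .cons h p₁, p₂, rfl, rfl⟩

theorem walk_append_left_cancel {G : SimpleGraph V} {a b c : V} (p : G.Walk a b)
    {q r : G.Walk b c} (h : p.append q = p.append r) : q = r := by
  induction p with
  | nil => exact h
  | cons _ _ ih => exact ih (by simpa using h)

theorem walk_append_right_cancel {G : SimpleGraph V} {a b c : V} {p q : G.Walk a b}
    (r : G.Walk b c) (h : p.append r = q.append r) : p = q := by
  have := walk_append_left_cancel r.reverse (by simpa using congrArg Walk.reverse h)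
  simpa using congrArg Walk.reverse this

theorem LexBetter.asymm [LinearOrder V] {G : SimpleGraph V} {w : Sym2 V → ℕ} {a b : V}
    {p q : G.Walk a b} (h : LexBetter w p q) : ¬ LexBetter w q p := by
  rintro (h' | ⟨_, h'⟩ | ⟨_, _, h'⟩) <;> rcases h with h | ⟨_, h⟩ | ⟨_, _, h⟩ <;>
    first | omega | exact lt_asymm h h'

theorem LexBetter.reverse [LinearOrder V] {G : SimpleGraph V} {w : Sym2 V → ℕ} {a b : V}
    {p q : G.Walk a b} (h : LexBetter w p q) : LexBetter w p.reverse q.reverse := by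
  simpa [LexBetter, walkWeight_reverse] using h

namespace IsLexShortestPath

variable [LinearOrder V] {G : SimpleGraph V} {w : Sym2 V → ℕ}

theorem eq {a b : V} {p q : G.Walk a b} (hp : IsLexShortestPath w p)
    (hq : IsLexShortestPath w q) : p = q := by
  by_contra hne
  exact (hp.2.2 q hq.1 (walkIn_univ_edgeSet q) (Ne.symm hne)).asymm
    (hq.2.2 p hp.1 (walkIn_univ_edgeSet p) hne)

theorem reverse {a b : V} {p : G.Walk a b} (hp : IsLexShortestPath w p) :
    IsLexShortestPath w p.reverse := by
  refine ⟨hp.1.reverse, walkIn_univ_edgeSet _, fun q hq _ hne => ?_⟩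
  have := hp.2.2 q.reverse hq.reverse (walkIn_univ_edgeSet _)
    (fun h => hne (by rw [← h, Walk.reverse_reverse]))
  simpa using this.reverse

/-- A contiguous part of a lex shortest path is a lex shortest path. -/
theorem of_append_append {a b c d : V} {p₁ : G.Walk a b} {p : G.Walk b c} {p₂ : G.Walk c d}
    (h : IsLexShortestPath w (p₁.append (p.append p₂))) : IsLexShortestPath w p := by
  have hp : p.IsPath := h.1.of_append_right.of_append_left
  refine ⟨hp, walkIn_univ_edgeSet p, fun q hq _ hne => ?_⟩
  set r := p₁.append (q.append p₂) with hr
  by_cases hrp : r.IsPath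
  · have hne' : r ≠ p₁.append (p.append p₂) := fun h' =>
      hne (walk_append_right_cancel p₂ (walk_append_left_cancel p₁ h'))
    have hlex := h.2.2 r hrp (walkIn_univ_edgeSet r) hne'
    have key : ∀ {s s' : G.Walk b c}, (p₁.append (s.append p₂)).IsPath →
        ((p₁.append (s.append p₂)).support.toFinset \ (p₁.append (s'.append p₂)).support.toFinset)
          = s.support.toFinset \ s'.support.toFinset := by
      intro s s' hs
      ext t
      simp only [Finset.mem_sdiff, List.mem_toFinset, Walk.mem_support_append_iff, not_or]
      refine ⟨by tauto, fun ⟨ht, ht'⟩ => ⟨.inr (.inl ht), fun h₁ => ?_, ht', fun h₂ => ?_⟩⟩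
      · have : t = b := by_contra fun hne => hs.ne_of_mem_support_of_append hne h₁
          ((Walk.mem_support_append_iff _ _).2 (.inl ht)) rfl
        exact ht' (this ▸ s'.start_mem_support)
      · have : t = c := by_contra fun hne =>
          hs.of_append_right.ne_of_mem_support_of_append hne ht h₂ rfl
        exact ht' (this ▸ s'.end_mem_support)
    rw [LexBetter, hr, key h.1, key hrp] at hlex
    simpa [LexBetter, walkWeight_append] using hlex
  · have hlt : r.bypass.length < r.length := by
      by_contra hle
      exact hrp (r.bypass_eq_self_of_length_le_length_bypass (not_lt.1 hle) ▸ r.bypass_isPath)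
    have hw := walkWeight_bypass_le w r
    have hwr : walkWeight w r = walkWeight w p₁ + (walkWeight w q + walkWeight w p₂) := by
      simp [hr, walkWeight_append]
    have hlr : r.length = p₁.length + (q.length + p₂.length) := by simp [hr]
    have hle : walkWeight w (p₁.append (p.append p₂)) < walkWeight w r.bypass ∨
        walkWeight w (p₁.append (p.append p₂)) = walkWeight w r.bypass ∧
        (p₁.append (p.append p₂)).length ≤ r.bypass.length := by
      by_cases heq : r.bypass = p₁.append (p.append p₂)
      · rw [heq]; exact .inr ⟨rfl, le_rfl⟩
      · rcases h.2.2 _ r.bypass_isPath (walkIn_univ_edgeSet _) heq with h | h | h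
        · exact .inl h
        · exact .inr ⟨h.1.symm, h.2.le⟩
        · exact .inr ⟨h.1.symm, h.2.1.ge⟩
    simp only [walkWeight_append, Walk.length_append] at hle
    by_cases hlt' : walkWeight w p < walkWeight w q
    · exact .inl hlt'
    · exact .inr (.inl ⟨by omega, by omega⟩)

/-- A lex shortest path between two vertices of a lex shortest path is part of the latter. -/
theorem subset_of_mem_support {a b c d : V} {p : G.Walk a b} {q : G.Walk c d}
    (hp : IsLexShortestPath w p) (hq : IsLexShortestPath w q)
    (hc : c ∈ p.support) (hd : d ∈ p.support) :
    q.support ⊆ p.support ∧ q.edges ⊆ p.edges := by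
  obtain ⟨p₁, p₂, rfl⟩ := Walk.mem_support_iff_exists_append.1 hc
  rcases (Walk.mem_support_append_iff _ _).1 hd with hd | hd
  · obtain ⟨p₃, p₄, rfl⟩ := Walk.mem_support_iff_exists_append.1 hd
    rw [← Walk.append_assoc] at hp
    have := hq.reverse.eq hp.of_append_append
    rw [← Walk.reverse_reverse q, this]
    constructor <;> intro t <;> simp <;> tauto
  · obtain ⟨p₃, p₄, rfl⟩ := Walk.mem_support_iff_exists_append.1 hd
    rw [hq.eq hp.of_append_append]
    constructor <;> intro t <;> simp <;> tauto

theorem lexShortCycle_mem_LSC {V₁ : Set V} {E₁ : Set (Sym2 V)} {C : G.Subgraph}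
    (hclosed : ∀ x ∈ V₁, ∀ y ∈ V₁, x ≠ y → ∀ p : G.Walk x y, IsLexShortestPath w p →
      WalkIn V₁ E₁ p)
    (hC : IsLexShortCycleIn w V₁ E₁ C) : C ∈ LSC G w := by
  obtain ⟨hV, -, hcyc, hlsp⟩ := hC
  refine ⟨Set.subset_univ _, C.edgeSet_subset, hcyc, fun x hx y hy hxy p hp => ?_⟩
  exact hlsp x hx y hy hxy p ⟨hp.1, hclosed x (hV hx) y (hV hy) hxy p hp,
    fun q hq _ hne => hp.2.2 q hq (walkIn_univ_edgeSet q) hne⟩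

end IsLexShortestPath

theorem IsComponentOf.mem_of_adj {G : SimpleGraph V} {A H : Set V} (hH : IsComponentOf G A H)
    {s t : V} (hs : s ∈ H) (ht : t ∈ A) (hst : G.Adj s t) : t ∈ H := by
  have hK := hH.2.2.2 (H ∪ {s, t}) Set.subset_union_left
    (Set.union_subset hH.2.1 (Set.insert_subset (hH.2.1 hs) (Set.singleton_subset_iff.2 ht)))
    (induce_union_connected hH.2.2.1.preconnected
      (induce_pair_connected_of_adj hst).preconnected ⟨s, hs, by simp⟩)
  rw [← hK]
  simp

theorem IsComponentOf.eq_or_eq_of_adj {G : SimpleGraph V} {u v : V} {H : Set V}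
    (hH : IsComponentOf G {t | t ≠ u ∧ t ≠ v} H) {s t : V} (hs : s ∈ H) (ht : t ∉ H)
    (hst : G.Adj s t) : t = u ∨ t = v := by
  by_contra h
  exact ht (hH.mem_of_adj hs (not_or.1 h) hst)

theorem IsComponentOf.exists_mem_support {G : SimpleGraph V} {u v : V} {H : Set V}
    (hH : IsComponentOf G {t | t ≠ u ∧ t ≠ v} H) {a b : V} (p : G.Walk a b)
    (ha : a ∈ H) (hb : b ∉ H) : ∃ t ∈ p.support, t = u ∨ t = v := by
  obtain ⟨d, hd, hd₁, hd₂⟩ := p.exists_boundary_dart H ha hb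
  exact ⟨d.snd, p.dart_snd_mem_support_of_mem_darts hd, hH.eq_or_eq_of_adj hd₁ hd₂ d.adj⟩

variable [Fintype V] [LinearOrder V]

theorem decomp_lexShortCycle_mem_lsc
    (G : SimpleGraph V) (w : Sym2 V → ℕ)
    (hconn : G.Connected) (h2t : IsPartialTwoTree G) (hout : ¬ IsOuterplanar G)
    (u v : V) (huv : u ≠ v) (hsep : IsSeparatorPair G u v)
    (hcomp3 : 3 ≤ numComponentsDel G u v)
    (P : G.Walk u v) (hP : IsLexShortestPath w P)
    (H : Set V) (hH : IsComponentOf G {t | t ≠ u ∧ t ≠ v} H)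
    (hHV : ∀ t ∈ P.support, t ∉ H) (hHE : ∀ e ∈ P.edges, e ∉ edgesWithin G H)
    (G₁ G₂ : G.Subgraph)
    (hV₁ : G₁.verts = decompVerts1 P H) (hE₁ : G₁.edgeSet = decompEdges1 P H)
    (hV₂ : G₂.verts = Hᶜ) (hE₂ : G₂.edgeSet = edgesWithin G Hᶜ) :
    (∀ C : G.Subgraph, IsLexShortCycleIn w G₁.verts G₁.edgeSet C → C ∈ LSC G w) ∧
    (∀ C : G.Subgraph, IsLexShortCycleIn w G₂.verts G₂.edgeSet C → C ∈ LSC G w) := by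
  have hu : u ∈ P.support := P.start_mem_support
  have hv : v ∈ P.support := P.end_mem_support
  have hPmem : ∀ t, t = u ∨ t = v → t ∈ P.support := by rintro t (rfl | rfl) <;> assumption
  refine ⟨fun C => IsLexShortestPath.lexShortCycle_mem_LSC fun x hx y hy hxy p hp => ?_,
    fun C => IsLexShortestPath.lexShortCycle_mem_LSC fun x hx y hy hxy p hp => ?_⟩
  · have hedges : ∀ e ∈ p.edges, e ∈ G₁.edgeSet := by
      rw [hV₁] at hx hy
      rw [hE₁]
      intro e he
      obtain ⟨c, d, h, p₁, p₂, rfl, rfl⟩ := exists_eq_append_cons_of_mem_edges p he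
      by_cases hc : c ∈ H
      · by_cases hd : d ∈ H
        · exact .inl (.inl ⟨h, by simp [hc, hd]⟩)
        · exact .inr ⟨c, hc, d, hH.eq_or_eq_of_adj hc hd h, h, rfl⟩
      by_cases hd : d ∈ H
      · exact .inr ⟨d, hd, c, hH.eq_or_eq_of_adj hd hc h.symm, h.symm, Sym2.eq_swap⟩
      have reach : ∀ {x c : V} (q : G.Walk x c), x ∈ decompVerts1 P H → c ∉ H →
          ∃ t ∈ q.support, t ∈ P.support := by
        rintro x c q (hx | hx) hc
        · obtain ⟨t, ht, ht'⟩ := hH.exists_mem_support q hx hc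
          exact ⟨t, ht, hPmem t ht'⟩
        · exact ⟨x, q.start_mem_support, hx⟩
      obtain ⟨a, ha, haP⟩ := reach p₁ hx hc
      obtain ⟨b, hb, hbP⟩ := reach p₂.reverse hy hd
      rw [Walk.support_reverse, List.mem_reverse] at hb
      obtain ⟨p₃, p₄, rfl⟩ := Walk.mem_support_iff_exists_append.1 ha
      obtain ⟨p₅, p₆, rfl⟩ := Walk.mem_support_iff_exists_append.1 hb
      rw [← Walk.append_assoc, ← Walk.cons_append, Walk.append_assoc p₄] at hp
      exact .inl (.inr ((hP.subset_of_mem_support hp.of_append_append haP hbP).2 (by simp)))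
    refine ⟨fun t ht => ?_, hedges⟩
    obtain ⟨e, he, hte⟩ := (Walk.mem_support_iff_exists_mem_edges_of_not_nil
      (Walk.not_nil_of_ne hxy)).1 ht
    exact G₁.mem_verts_of_mem_edge (hedges e he) hte
  · rw [hV₂] at hx hy ⊢
    rw [hE₂]
    have hsupp : ∀ t ∈ p.support, t ∈ Hᶜ := by
      intro z hz hzH
      obtain ⟨p₁, p₂, rfl⟩ := Walk.mem_support_iff_exists_append.1 hz
      obtain ⟨a, ha, ha'⟩ := hH.exists_mem_support p₁.reverse hzH hx
      obtain ⟨b, hb, hb'⟩ := hH.exists_mem_support p₂ hzH hy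
      rw [Walk.support_reverse, List.mem_reverse] at ha
      obtain ⟨p₃, p₄, rfl⟩ := Walk.mem_support_iff_exists_append.1 ha
      obtain ⟨p₅, p₆, rfl⟩ := Walk.mem_support_iff_exists_append.1 hb
      rw [← Walk.append_assoc, Walk.append_assoc p₄] at hp
      exact hHV z ((hP.subset_of_mem_support hp.of_append_append (hPmem a ha')
        (hPmem b hb')).1 (by simp)) hzH
    exact ⟨hsupp, fun e he => ⟨p.edges_subset_edgeSet he,
      fun t ht => hsupp t (Walk.mem_support_of_mem_edges he ht)⟩⟩

end LexMCB
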